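/- arXiv:2201.12410 — 2 statements merged into one kernel-verified Lean document; each statement's English description precedes it below -/
import Mathlib

section
/- For every natural number n with n ≠ 4 and n ≠ 6 (and n ≥ 2), the lexicographic product D = C⃗_{n²−n}[C⃗_n] of the directed cycle on n²−n vertices with the directed cycle on n vertices is n²-minimal, and hence its diachromatic number equals its harmonious chromatic number equals n². -/
/-- A set of vertices is acyclic in a digraph if the induced subdigraph
contains no directed cycle (no vertex reaches itself through the set). -/
def Digraph.AcyclicOn {V : Type*} (D : Digraph V) (S : Set V) : Prop :=
  ¬ ∃ v, Relation.TransGen (fun a b => a ∈ S ∧ b ∈ S ∧ D.Adj a b) v v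

/-- A `k`-coloring is acyclic if every color class induces an acyclic subdigraph. -/
def Digraph.IsAcyclicColoring {V : Type*} {k : ℕ} (D : Digraph V) (c : V → Fin k) : Prop :=
  ∀ i : Fin k, D.AcyclicOn {v | c v = i}

/-- A `k`-coloring is complete if for every ordered pair of distinct colors
there is at least one arc from the first color to the second. -/
def Digraph.IsCompleteColoring {V : Type*} {k : ℕ} (D : Digraph V) (c : V → Fin k) : Prop :=
  ∀ i j : Fin k, i ≠ j → ∃ u v, D.Adj u v ∧ c u = i ∧ c v = j

/-- A coloring is proper if no arc joins two vertices of the same color. -/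
def Digraph.IsProperColoring {V : Type*} {k : ℕ} (D : Digraph V) (c : V → Fin k) : Prop :=
  ∀ u v, D.Adj u v → c u ≠ c v

/-- A coloring is harmonious if it is proper and for every ordered pair of
distinct colors there is at most one arc from the first color to the second. -/
def Digraph.IsHarmoniousColoring {V : Type*} {k : ℕ} (D : Digraph V) (c : V → Fin k) : Prop :=
  D.IsProperColoring c ∧
    ∀ u v u' v', D.Adj u v → D.Adj u' v' → c u = c u' → c v = c v' → c u ≠ c v →
      u = u' ∧ v = v'

/-- A coloring is balanced if all color classes have the same cardinality. -/
def IsBalancedColoring {V : Type*} {k : ℕ} (c : V → Fin k) : Prop :=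
  ∀ i j : Fin k, Nat.card {v // c v = i} = Nat.card {v // c v = j}

/-- The dichromatic number: the least `k` admitting an acyclic `k`-coloring. -/
noncomputable def Digraph.dichromaticNumber {V : Type*} (D : Digraph V) : ℕ :=
  sInf {k | ∃ c : V → Fin k, D.IsAcyclicColoring c}

/-- The diachromatic number: the greatest `k` admitting an acyclic complete `k`-coloring. -/
noncomputable def Digraph.diachromaticNumber {V : Type*} (D : Digraph V) : ℕ :=
  sSup {k | ∃ c : V → Fin k, D.IsAcyclicColoring c ∧ D.IsCompleteColoring c}

/-- The harmonious chromatic number: the least `k` admitting a harmonious `k`-coloring. -/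
noncomputable def Digraph.harmoniousNumber {V : Type*} (D : Digraph V) : ℕ :=
  sInf {k | ∃ c : V → Fin k, D.IsHarmoniousColoring c}

/-- The number of arcs (the size) of a digraph. -/
noncomputable def Digraph.arcCount {V : Type*} (D : Digraph V) : ℕ :=
  Nat.card {p : V × V // D.Adj p.1 p.2}

/-- Deletion of the arc `(u, v)` from a digraph. -/
def Digraph.deleteArc {V : Type*} (D : Digraph V) (u v : V) : Digraph V :=
  ⟨fun a b => D.Adj a b ∧ ¬(a = u ∧ b = v)⟩

/-- A digraph is `k`-minimal if its diachromatic number is `k` and deleting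
any arc decreases the diachromatic number below `k`. -/
def Digraph.IsKMinimal {V : Type*} (D : Digraph V) (k : ℕ) : Prop :=
  D.diachromaticNumber = k ∧
    ∀ u v, D.Adj u v → (D.deleteArc u v).diachromaticNumber < k

/-- The complete symmetric digraph on a vertex type. -/
def completeDigraph (V : Type*) : Digraph V := ⟨fun a b => a ≠ b⟩

/-- The directed cycle on `m` vertices. -/
def dirCycle (m : ℕ) : Digraph (ZMod m) := ⟨fun a b => b = a + 1⟩

/-- The lexicographic product of digraphs. -/
def lexProd {V W : Type*} (D : Digraph V) (H : Digraph W) : Digraph (V × W) :=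
  ⟨fun x y => D.Adj x.1 y.1 ∨ (x.1 = y.1 ∧ H.Adj x.2 y.2)⟩

/-- Vertex type of the `i`-fold iterated lexicographic product. -/
def iterType (V W : Type u) : ℕ → Type u
  | 0 => V
  | i + 1 => iterType V W i × W

/-- The iterated lexicographic product `D[H]^i` (with `D[H]^0 = D`). -/
def iterLex {V W : Type u} (D : Digraph V) (H : Digraph W) : (i : ℕ) → Digraph (iterType V W i)
  | 0 => D
  | i + 1 => lexProd (iterLex D H i) H

/-- The Zykov sum of the family `H` of mutually vertex-disjoint digraphs over `D`. -/
def zykovSum {V : Type*} {W : V → Type*} (D : Digraph V) (H : ∀ u, Digraph (W u)) :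
    Digraph (Σ u, W u) :=
  ⟨fun x y => D.Adj x.1 y.1 ∨ ∃ h : x.1 = y.1, (H y.1).Adj (h ▸ x.2) y.2⟩

open Relation in
/-- The maps `σ q`, `q < n - 1`, describe the successor relations of `n - 1` directed Hamiltonian
cycles on `{0, …, n - 1}` which together cover every arc of the complete symmetric digraph. -/
structure IsHamFactorization (n : ℕ) (σ : ℕ → ℕ → ℕ) : Prop where
  lt : ∀ q < n - 1, ∀ x < n, σ q x < n
  reach : ∀ q < n - 1, ∀ x < n, ∀ y < n, ReflTransGen (fun a b => σ q a = b) x y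
  cover : ∀ u < n, ∀ v < n, u ≠ v → ∃ q < n - 1, σ q u = v

namespace IsHamFactorization

open Relation

/-- Insert the new vertex `n` into every Hamiltonian cycle `σ q`, between `u q` and its successor.
The removed arcs, together with two arcs at the new vertex, form the new cycle `τ`. -/
theorem insert {n : ℕ} {σ : ℕ → ℕ → ℕ} (h : IsHamFactorization n σ) (hn : 0 < n) (u τ : ℕ → ℕ)
    (hu : ∀ q < n - 1, u q < n) (hτ : ∀ x ≤ n, τ x ≤ n)
    (hreach : ∀ x ≤ n, ∀ y ≤ n, ReflTransGen (fun a b => τ a = b) x y)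
    (hτu : ∀ q < n - 1, τ (u q) = σ q (u q))
    (hcov : ∀ x < n, (∃ q < n - 1, u q = x) ∨ τ x = n) :
    IsHamFactorization (n + 1) fun q x =>
      if q = n - 1 then τ x else if x = n then σ q (u q) else if x = u q then n else σ q x := by
  refine ⟨?_, ?_, ?_⟩
  · intro q hq x hx
    split_ifs with h1 h2 h3
    · have := hτ x (by omega); omega
    · have := h.lt q (by omega) (u q) (hu q (by omega)); omega
    · omega
    · have := h.lt q (by omega) x (by omega); omega
  · intro q hq x hx y hy
    by_cases h1 : q = n - 1
    · simpa [h1] using hreach x (by omega) y (by omega)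
    · simp only [h1, if_false]
      have hq' : q < n - 1 := by omega
      set R : ℕ → ℕ → Prop := fun a b =>
        (if a = n then σ q (u q) else if a = u q then n else σ q a) = b with hR
      have huq := hu q hq'
      have hout : R n (σ q (u q)) := by simp [hR]
      have hin : R (u q) n := by simp [hR, huq.ne]
      have hold : ∀ a < n, ∀ b, ReflTransGen (fun a b => σ q a = b) a b →
          b < n ∧ ReflTransGen R a b := by
        intro a ha b hab
        induction hab with
        | refl => exact ⟨ha, .refl⟩
        | @tail b c _ hbc ih =>
          subst hbc
          refine ⟨h.lt q hq' b ih.1, ih.2.trans ?_⟩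
          by_cases hb : b = u q
          · subst hb
            exact (ReflTransGen.single hin).tail hout
          · exact .single (by simp [hR, hb, ih.1.ne])
      have hfrom : ∀ y < n, ReflTransGen R n y := fun y hy =>
        .head hout (hold _ (h.lt q hq' _ huq) _ (h.reach q hq' _ (h.lt q hq' _ huq) y hy)).2
      have hto : ∀ x < n, ReflTransGen R x n := fun x hx =>
        (hold x hx _ (h.reach q hq' x hx _ huq)).2.tail hin
      rcases Nat.lt_succ_iff_lt_or_eq.1 hx with hx | rfl
      · rcases Nat.lt_succ_iff_lt_or_eq.1 hy with hy | rfl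
        · exact (hold x hx y (h.reach q hq' x hx y hy)).2
        · exact hto x hx
      · rcases Nat.lt_succ_iff_lt_or_eq.1 hy with hy | rfl
        · exact hfrom y hy
        · exact .refl
  · intro a ha b hb hab
    have hmain : τ a = b → ∃ q < n + 1 - 1, (if q = n - 1 then τ a else if a = n then σ q (u q)
        else if a = u q then n else σ q a) = b := fun hτa => ⟨n - 1, by omega, by simp [hτa]⟩
    by_cases han : a = n
    · subst han
      have hsurj : ∃ c ≤ a, τ c = b := by
        rcases (hreach a le_rfl b (by omega)).cases_tail with h0 | ⟨c, hc, hcb⟩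
        · exact absurd h0.symm hab
        · refine ⟨c, ?_, hcb⟩
          clear hcb
          induction hc with
          | refl => exact le_rfl
          | tail _ h2 ih => exact h2 ▸ hτ _ ih
      obtain ⟨c, hc, hcb⟩ := hsurj
      rcases hc.lt_or_eq with hc | rfl
      · rcases hcov c hc with ⟨q, hq, rfl⟩ | h0
        · refine ⟨q, by omega, ?_⟩
          rw [if_neg (by omega), if_pos rfl, ← hτu q hq, hcb]
        · omega
      · exact hmain hcb
    · rcases Nat.lt_succ_iff_lt_or_eq.1 hb with hb | rfl
      · obtain ⟨q, hq, hqa⟩ := h.cover a (by omega) b hb hab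
        by_cases hau : a = u q
        · subst hau
          exact hmain ((hτu q hq).trans hqa)
        · exact ⟨q, by omega, by rw [if_neg (by omega), if_neg han, if_neg hau, hqa]⟩
      · rcases hcov a (by omega) with ⟨q, hq, rfl⟩ | h0
        · exact ⟨q, by omega, by rw [if_neg (by omega), if_neg han, if_pos rfl]⟩
        · exact hmain h0

end IsHamFactorization

/-- Successor map of the `i`-th rotation of the zigzag Hamiltonian cycle
`∞, 0, 1, 2k - 1, 2, 2k - 2, …, k` on `ℤ / 2k ∪ {∞}`, where `∞` is encoded as `2k`. -/
def zigzag (k i x : ℕ) : ℕ :=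
  if x = 2 * k then i
  else if x = i then (if i + 1 < 2 * k then i + 1 else 0)
  else if i < x then
    (if x < i + k then (if 2 * i < x then 2 * i + 2 * k - x else 2 * i - x)
    else if x = i + k then 2 * k
    else (if 2 * i + 1 < x then 2 * i + 2 * k + 1 - x else 2 * i + 1 - x))
  else
    (if x + k < i then (if 2 * i < x + 2 * k then 2 * i - x else 2 * i - x - 2 * k)
    else if x + k = i then 2 * k
    else (if 2 * i + 1 < x + 2 * k then 2 * i + 1 - x else 2 * i + 1 - x - 2 * k))

open Relation in
theorem isHamFactorization_zigzag {k : ℕ} (hk : 1 ≤ k) :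
    IsHamFactorization (2 * k + 1) (zigzag k) := by
  refine ⟨?_, ?_, ?_⟩
  · intro q hq x hx
    unfold zigzag
    lia
  · intro i hi
    have hi : i < 2 * k := by omega
    set R : ℕ → ℕ → Prop := fun a b => zigzag k i a = b
    let tr : ℕ → ℕ := fun r => if i + r < 2 * k then i + r else i + r - 2 * k
    have hstart : R (2 * k) (tr 0) := by
      simp only [R, tr, zigzag]; lia
    have hfirst : R (tr 0) (tr 1) := by
      simp only [R, tr, zigzag]; lia
    have hdown : ∀ r, 1 ≤ r → r < k → R (tr r) (tr (2 * k - r)) := by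
      intro r h1 h2
      simp only [R, tr, zigzag]; lia
    have hup : ∀ r, 1 ≤ r → r < k → R (tr (2 * k - r)) (tr (r + 1)) := by
      intro r h1 h2
      simp only [R, tr, zigzag]; lia
    have hend : R (tr k) (2 * k) := by
      simp only [R, tr, zigzag]; lia
    have hfrom : ∀ r, r + 1 ≤ k → ReflTransGen R (2 * k) (tr (r + 1)) := by
      intro r
      induction r with
      | zero => exact fun _ => (ReflTransGen.single hstart).tail hfirst
      | succ r ih =>
        exact fun hr => ((ih (by omega)).tail (hdown _ (by omega) (by omega))).tail
          (hup _ (by omega) (by omega))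
    have hto : ∀ j, j + 1 ≤ k → ReflTransGen R (tr (k - j)) (2 * k) := by
      intro j
      induction j with
      | zero => exact fun _ => .single hend
      | succ j ih =>
        intro hj
        have h1 := hup (k - (j + 1)) (by omega) (by omega)
        rw [show k - (j + 1) + 1 = k - j by omega] at h1
        exact .head (hdown _ (by omega) (by omega)) (.head h1 (ih (by omega)))
    have hboth : ∀ x < 2 * k + 1, ReflTransGen R (2 * k) x ∧ ReflTransGen R x (2 * k) := by
      intro x hx
      rcases Nat.lt_succ_iff_lt_or_eq.1 hx with hx | rfl
      · obtain ⟨r, hr, rfl⟩ : ∃ r < 2 * k, tr r = x := by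
          by_cases h : i ≤ x
          · exact ⟨x - i, by omega, by simp only [tr]; lia⟩
          · exact ⟨x + 2 * k - i, by omega, by simp only [tr]; lia⟩
        rcases Nat.eq_zero_or_pos r with rfl | hr0
        · have := hto (k - 1) (by omega)
          rw [show k - (k - 1) = 1 by omega] at this
          exact ⟨.single hstart, .head hfirst this⟩
        · by_cases hrk : r ≤ k
          · have h1 := hfrom (r - 1) (by omega)
            have h2 := hto (k - r) (by omega)
            rw [show r - 1 + 1 = r by omega] at h1
            rw [show k - (k - r) = r by omega] at h2
            exact ⟨h1, h2⟩
          · have h1 := hfrom (2 * k - r - 1) (by omega)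
            have h2 := hto (k - (2 * k - r + 1)) (by omega)
            have h3 := hdown (2 * k - r) (by omega) (by omega)
            have h4 := hup (2 * k - r) (by omega) (by omega)
            rw [show 2 * k - r - 1 + 1 = 2 * k - r by omega] at h1
            rw [show k - (k - (2 * k - r + 1)) = 2 * k - r + 1 by omega] at h2
            rw [show 2 * k - (2 * k - r) = r by omega] at h3 h4
            exact ⟨h1.tail h3, .head h4 h2⟩
      · exact ⟨.refl, .refl⟩
    exact fun x hx y hy => (hboth x hx).2.trans (hboth y hy).1
  · intro u hu v hv huv
    -- the arc `u → v` lies in the cycle whose index is the appropriate midpoint of `u` and `v`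
    obtain ⟨j, hj | hj⟩ := Nat.even_or_odd' (u + v)
    all_goals
      by_cases hu0 : u = 2 * k
      · exact ⟨v, by omega, by unfold zigzag; lia⟩
      by_cases hv0 : v = 2 * k
      · by_cases huk : k ≤ u
        · exact ⟨u - k, by omega, by unfold zigzag; lia⟩
        · exact ⟨u + k, by omega, by unfold zigzag; lia⟩
      by_cases huv : u < v
    · by_cases hjk : j < k
      · exact ⟨j + k, by omega, by unfold zigzag; lia⟩
      · exact ⟨j - k, by omega, by unfold zigzag; lia⟩
    · exact ⟨j, by omega, by unfold zigzag; lia⟩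
    · exact ⟨j, by omega, by unfold zigzag; lia⟩
    · by_cases hjk : j < k
      · exact ⟨j + k, by omega, by unfold zigzag; lia⟩
      · exact ⟨j - k, by omega, by unfold zigzag; lia⟩

/-- The vertex of the zigzag cycle with index `i` after which a new vertex is inserted. -/
def zigzagCut (k i : ℕ) : ℕ :=
  if i + 1 = 2 * k then k
  else if i = 0 then k + 1
  else if i + 1 = k then 0
  else if i = k then k + 2
  else if i = k + 1 then 1
  else i + 1

/-- The cycle through the new vertex `2k + 1`, the arcs of which are cut from the zigzag cycles:
after `2k + 1` it descends from `2k - 2` to `0` and then from `2k - 1` to `1` in steps of two,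
except that `k` is visited between `k + 1` and `k - 1` instead of between `k + 2` and `k - 2`. -/
def zigzagCutCycle (k x : ℕ) : ℕ :=
  if x = 2 * k + 1 then 2 * k - 2
  else if x = 2 * k then 2 * k + 1
  else if x = k + 1 then k
  else if x = k then k - 1
  else if x = k + 2 then k - 2
  else if x = 0 then 2 * k - 1
  else if x = 1 then 2 * k
  else x - 2

set_option maxHeartbeats 1000000 in
open Relation in
theorem zigzagCutCycle_reach {k : ℕ} (hk : 3 ≤ k) (x : ℕ) (hx : x ≤ 2 * k + 1) (y : ℕ)
    (hy : y ≤ 2 * k + 1) : ReflTransGen (fun a b => zigzagCutCycle k a = b) x y := by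
  set R : ℕ → ℕ → Prop := fun a b => zigzagCutCycle k a = b
  have hstep : ∀ a b, zigzagCutCycle k a = b → R a b := fun _ _ h => h
  have hnew : R (2 * k + 1) (2 * k - 2) := hstep _ _ (by simp [zigzagCutCycle])
  have hinf : R (2 * k) (2 * k + 1) := hstep _ _ (by simp [zigzagCutCycle])
  have hone : R 1 (2 * k) := hstep _ _ (by unfold zigzagCutCycle; lia)
  have hzero : R 0 (2 * k - 1) := hstep _ _ (by unfold zigzagCutCycle; lia)
  have hk1 : R (k + 1) k := hstep _ _ (by unfold zigzagCutCycle; lia)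
  have hk2 : R (k + 2) (k - 2) := hstep _ _ (by unfold zigzagCutCycle; lia)
  have hk0 : R k (k - 1) := hstep _ _ (by unfold zigzagCutCycle; lia)
  have hgen : ∀ a, a < 2 * k → 2 ≤ a → a ≠ k → a ≠ k + 1 → a ≠ k + 2 →
      R a (a - 2) := fun a _ _ _ _ _ => hstep _ _ (by unfold zigzagCutCycle; lia)
  -- the vertices visited after `0`
  let O : ℕ → Prop := fun a => (a % 2 = 1 ∧ a ≠ k) ∨ (a % 2 = 0 ∧ a = k)
  have hOto : ∀ a, a < 2 * k → O a → ReflTransGen R a 1 := by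
    intro a
    induction a using Nat.strong_induction_on with
    | _ a ih =>
      intro ha hO
      simp only [O] at hO ih
      by_cases h1 : a = 1
      · exact h1 ▸ .refl
      by_cases h2 : a = k
      · exact .head (h2 ▸ hk0) (ih _ (by omega) (by omega) (by omega))
      by_cases h3 : a = k + 1
      · exact .head (h3 ▸ hk1) (ih _ (by omega) (by omega) (by omega))
      by_cases h4 : a = k + 2
      · exact .head (h4 ▸ hk2) (ih _ (by omega) (by omega) (by omega))
      exact .head (hgen a ha (by omega) h2 h3 h4) (ih _ (by omega) (by omega) (by omega))
  have hlast := hOto (2 * k - 1) (by omega) (by simp only [O]; lia)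
  have hEto : ∀ a, a < 2 * k → ReflTransGen R a 1 := by
    intro a
    induction a using Nat.strong_induction_on with
    | _ a ih =>
      intro ha
      by_cases h1 : a = 1
      · exact h1 ▸ .refl
      by_cases h0 : a = 0
      · exact h0 ▸ .head hzero hlast
      by_cases h2 : a = k
      · exact .head (h2 ▸ hk0) (ih _ (by omega) (by omega))
      by_cases h3 : a = k + 1
      · exact .head (h3 ▸ hk1) (ih _ (by omega) (by omega))
      by_cases h4 : a = k + 2
      · exact .head (h4 ▸ hk2) (ih _ (by omega) (by omega))
      exact .head (hgen a ha (by omega) h2 h3 h4) (ih _ (by omega) (by omega))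
  have hto : ∀ a ≤ 2 * k + 1, ReflTransGen R a (2 * k + 1) := by
    intro a ha
    by_cases h1 : a = 2 * k + 1
    · exact h1 ▸ .refl
    by_cases h2 : a = 2 * k
    · subst h2; exact .single hinf
    exact ((hEto a (by omega)).tail hone).tail hinf
  have hpred : ∀ a, a + 2 < 2 * k → ∃ b, a < b ∧ b < 2 * k ∧ R b a ∧ (O b ↔ O a) := by
    intro a ha
    by_cases h1 : a = k
    · subst h1; exact ⟨a + 1, by omega, by omega, hk1, by simp only [O]; lia⟩
    by_cases h2 : a + 1 = k
    · subst h2; exact ⟨a + 1, by omega, by omega, hk0, by simp only [O]; lia⟩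
    by_cases h3 : a + 2 = k
    · subst h3; exact ⟨a + 4, by omega, by omega, hk2, by simp only [O]; lia⟩
    exact ⟨a + 2, by omega, by omega, hgen _ ha (by omega) (by omega) (by omega) (by omega), by
      simp only [O]; lia⟩
  have hEfrom : ∀ j a, a + j = 2 * k → 0 < j → ¬ O a → ReflTransGen R (2 * k + 1) a := by
    intro j
    induction j using Nat.strong_induction_on with
    | _ j ih =>
      intro a haj hj hO
      by_cases h1 : a + 2 < 2 * k
      · obtain ⟨b, hab, hb, hR, hOb⟩ := hpred a h1
        exact (ih (2 * k - b) (by omega) b (by omega) (by omega) (by tauto)).tail hR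
      · have : a = 2 * k - 2 := by simp only [O] at hO; omega
        exact this ▸ .single hnew
  have hOfrom : ∀ j a, a + j = 2 * k → 0 < j → O a → ReflTransGen R (2 * k + 1) a := by
    intro j
    induction j using Nat.strong_induction_on with
    | _ j ih =>
      intro a haj hj hO
      by_cases h1 : a + 2 < 2 * k
      · obtain ⟨b, hab, hb, hR, hOb⟩ := hpred a h1
        exact (ih (2 * k - b) (by omega) b (by omega) (by omega) (by tauto)).tail hR
      · have : a = 2 * k - 1 := by simp only [O] at hO; omega
        exact this ▸ (hEfrom (2 * k) 0 (by omega) (by omega) (by simp only [O]; lia)).tail hzero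
  have hfrom : ∀ a ≤ 2 * k + 1, ReflTransGen R (2 * k + 1) a := by
    intro a ha
    by_cases h1 : a = 2 * k + 1
    · exact h1 ▸ .refl
    by_cases h2 : a = 2 * k
    · exact h2 ▸ (hOfrom (2 * k - 1) 1 (by omega) (by omega) (by simp only [O]; lia)).tail hone
    by_cases hO : O a
    · exact hOfrom (2 * k - a) a (by omega) (by omega) hO
    · exact hEfrom (2 * k - a) a (by omega) (by omega) hO
  exact (hto x hx).trans (hfrom y hy)

theorem exists_isHamFactorization {n : ℕ} (hn : 2 ≤ n) (h4 : n ≠ 4) (h6 : n ≠ 6) :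
    ∃ σ, IsHamFactorization n σ := by
  obtain ⟨k, rfl | rfl⟩ := Nat.even_or_odd' n
  · by_cases hk1 : k = 1
    · subst hk1
      refine ⟨fun _ x => 1 - x, ?_, ?_, ?_⟩
      · intros; omega
      · intro q _ x hx y hy
        by_cases hxy : x = y
        · exact hxy ▸ .refl
        · exact .single (by omega)
      · exact fun u hu v hv huv => ⟨0, by omega, by omega⟩
    · obtain ⟨l, rfl⟩ : ∃ l, k = l + 1 := ⟨k - 1, by omega⟩
      have hl : 3 ≤ l := by omega
      refine ⟨_, (isHamFactorization_zigzag (k := l) (by omega)).insert (by omega) (zigzagCut l)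
        (zigzagCutCycle l) ?_ ?_ (zigzagCutCycle_reach hl) ?_ ?_⟩
      · intro q hq
        unfold zigzagCut
        lia
      · intro x hx
        unfold zigzagCutCycle
        lia
      · intro q hq
        unfold zigzagCut
        split_ifs <;> unfold zigzag zigzagCutCycle <;> lia
      · intro x hx
        by_cases h0 : x = 2 * l
        · exact .inr (by simp [zigzagCutCycle, h0])
        left
        by_cases h1 : x = l
        · exact ⟨2 * l - 1, by omega, by unfold zigzagCut; lia⟩
        by_cases h2 : x = l + 1
        · exact ⟨0, by omega, by unfold zigzagCut; lia⟩
        by_cases h3 : x = 0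
        · exact ⟨l - 1, by omega, by unfold zigzagCut; lia⟩
        by_cases h4 : x = l + 2
        · exact ⟨l, by omega, by unfold zigzagCut; lia⟩
        by_cases h5 : x = 1
        · exact ⟨l + 1, by omega, by unfold zigzagCut; lia⟩
        exact ⟨x - 1, by omega, by unfold zigzagCut; lia⟩
  · exact ⟨_, isHamFactorization_zigzag (by omega)⟩

namespace IsHamFactorization

variable {n : ℕ} {σ : ℕ → ℕ → ℕ}

theorem iterate_lt (h : IsHamFactorization n σ) {q : ℕ} (hq : q < n - 1) (t : ℕ) :
    (σ q)^[t] 0 < n := by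
  induction t with
  | zero => exact (by omega : 0 < n)
  | succ t ih => rw [Function.iterate_succ_apply']; exact h.lt q hq _ ih

theorem exists_iterate_eq (h : IsHamFactorization n σ) {q x y : ℕ} (hq : q < n - 1) (hx : x < n)
    (hy : y < n) : ∃ t, (σ q)^[t] x = y := by
  have hxy := h.reach q hq x hx y hy
  clear hy
  induction hxy with
  | refl => exact ⟨0, rfl⟩
  | tail _ hbc ih =>
    obtain ⟨t, rfl⟩ := ih
    exact ⟨t + 1, by rw [Function.iterate_succ_apply', hbc]⟩

theorem minimalPeriod_eq (h : IsHamFactorization n σ) {q : ℕ} (hq : q < n - 1) :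
    Function.minimalPeriod (σ q) 0 = n := by
  obtain ⟨t, ht⟩ := h.exists_iterate_eq hq (h.lt q hq 0 (by omega)) (by omega : 0 < n)
  have hpos : 0 < Function.minimalPeriod (σ q) 0 :=
    Function.IsPeriodicPt.minimalPeriod_pos (n := t + 1) (by omega) ht
  have hbij : Set.BijOn (fun t => (σ q)^[t] 0)
      (Finset.range (Function.minimalPeriod (σ q) 0)) (Finset.range n) := by
    refine ⟨fun t _ => by simpa using h.iterate_lt hq t, ?_, fun y hy => ?_⟩
    · simpa [Set.Iio] using Function.iterate_injOn_Iio_minimalPeriod (f := σ q) (x := 0)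
    · obtain ⟨t, ht⟩ := h.exists_iterate_eq hq (by omega : 0 < n) (by simpa using hy : y < n)
      exact ⟨t % Function.minimalPeriod (σ q) 0, by simpa using Nat.mod_lt _ hpos,
        by simpa only [Function.iterate_mod_minimalPeriod_eq] using ht⟩
  simpa using Finset.card_nbij _ hbij.mapsTo hbij.injOn hbij.surjOn

theorem iterate_self (h : IsHamFactorization n σ) {q : ℕ} (hq : q < n - 1) :
    (σ q)^[n] 0 = 0 := by
  have := Function.iterate_minimalPeriod (f := σ q) (x := 0)
  rwa [h.minimalPeriod_eq hq] at this

theorem exists_lt_iterate_eq (h : IsHamFactorization n σ) {q y : ℕ} (hq : q < n - 1)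
    (hy : y < n) : ∃ t < n, (σ q)^[t] 0 = y := by
  obtain ⟨t, rfl⟩ := h.exists_iterate_eq hq (by omega : 0 < n) hy
  refine ⟨t % n, Nat.mod_lt _ (by omega), ?_⟩
  conv_lhs => rw [← h.minimalPeriod_eq hq, Function.iterate_mod_minimalPeriod_eq]

theorem iterate_succ_mod (h : IsHamFactorization n σ) {q : ℕ} (hq : q < n - 1) (t : ℕ) :
    (σ q)^[(t + 1) % n] 0 = σ q ((σ q)^[t] 0) := by
  rw [← Function.iterate_succ_apply' (σ q)]
  conv_lhs => rw [← h.minimalPeriod_eq hq, Function.iterate_mod_minimalPeriod_eq]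

end IsHamFactorization

theorem card_offDiag_fin (k : ℕ) : Nat.card {p : Fin k × Fin k // p.1 ≠ p.2} = k * (k - 1) := by
  have : {p : Fin k × Fin k // p.1 ≠ p.2} ≃ (Finset.univ.offDiag : Finset (Fin k × Fin k)) :=
    Equiv.subtypeEquivRight (by simp)
  rw [Nat.card_congr this, Nat.card_eq_fintype_card, Fintype.card_coe, Finset.offDiag_card]
  simp [Nat.mul_sub]

theorem mul_sub_one_lt_mul_sub_one {a b : ℕ} (hb : 2 ≤ b) (h : a < b) : a * (a - 1) < b * (b - 1) :=
  Nat.mul_lt_mul_of_lt_of_le h (by omega) (by omega)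

namespace Digraph

variable {V : Type*} {D : Digraph V} {k : ℕ}

theorem IsProperColoring.isAcyclicColoring {c : V → Fin k} (hc : D.IsProperColoring c) :
    D.IsAcyclicColoring c := by
  rintro i ⟨v, hv⟩
  obtain ⟨w, ⟨hv, hw, hvw⟩, -⟩ := Relation.TransGen.head'_iff.1 hv
  exact hc v w hvw (hv.trans hw.symm)

theorem IsCompleteColoring.exists_injective {c : V → Fin k} (hc : D.IsCompleteColoring c) :
    ∃ f : {p : Fin k × Fin k // p.1 ≠ p.2} → {a : V × V // D.Adj a.1 a.2},
      f.Injective ∧ ∀ p, c (f p).1.1 = p.1.1 ∧ c (f p).1.2 = p.1.2 := by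
  choose u v huv hu hv using hc
  refine ⟨fun p => ⟨(u _ _ p.2, v _ _ p.2), huv _ _ p.2⟩, ?_, fun p => ⟨hu _ _ p.2, hv _ _ p.2⟩⟩
  intro p q hpq
  simp only [Subtype.mk.injEq, Prod.mk.injEq] at hpq
  ext1
  ext1
  · rw [← hu _ _ p.2, hpq.1, hu]
  · rw [← hv _ _ p.2, hpq.2, hv]

theorem IsHarmoniousColoring.arcCount_le {c : V → Fin k} (hc : D.IsHarmoniousColoring c) :
    D.arcCount ≤ k * (k - 1) := by
  rw [← card_offDiag_fin]
  refine Nat.card_le_card_of_injective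
    (fun a : {a : V × V // D.Adj a.1 a.2} => ⟨(c a.1.1, c a.1.2), hc.1 _ _ a.2⟩) ?_
  intro a b hab
  simp only [Subtype.mk.injEq, Prod.mk.injEq] at hab
  have := hc.2 _ _ _ _ a.2 b.2 hab.1 hab.2 (hc.1 _ _ a.2)
  exact Subtype.ext (Prod.ext this.1 this.2)

variable [Finite V]

theorem IsCompleteColoring.le_arcCount {c : V → Fin k} (hc : D.IsCompleteColoring c) :
    k * (k - 1) ≤ D.arcCount := by
  obtain ⟨f, hf, -⟩ := hc.exists_injective
  exact card_offDiag_fin k ▸ Nat.card_le_card_of_injective f hf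

theorem IsCompleteColoring.isHarmoniousColoring {c : V → Fin k} (hc : D.IsCompleteColoring c)
    (hD : D.arcCount = k * (k - 1)) : D.IsHarmoniousColoring c := by
  obtain ⟨f, hf, hfc⟩ := hc.exists_injective
  have hsurj : f.Surjective := by
    refine (hf.bijective_of_nat_card_le ?_).surjective
    rw [card_offDiag_fin]
    exact hD.le
  refine ⟨fun u v huv => ?_, fun u v u' v' h h' hu hv _ => ?_⟩
  · obtain ⟨p, hp⟩ := hsurj ⟨(u, v), huv⟩
    have := hfc p
    rw [hp] at this
    rw [this.1, this.2]
    exact p.2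
  · obtain ⟨p, hp⟩ := hsurj ⟨(u, v), h⟩
    obtain ⟨q, hq⟩ := hsurj ⟨(u', v'), h'⟩
    have h1 := hfc p
    have h2 := hfc q
    rw [hp] at h1
    rw [hq] at h2
    obtain rfl : p = q :=
      Subtype.ext (Prod.ext (h1.1.symm.trans (hu.trans h2.1)) (h1.2.symm.trans (hv.trans h2.2)))
    simpa using hp.symm.trans hq

theorem arcCount_deleteArc_lt {u v : V} (huv : D.Adj u v) :
    (D.deleteArc u v).arcCount < D.arcCount := by
  refine Set.ncard_lt_ncard (s := {a : V × V | (D.deleteArc u v).Adj a.1 a.2})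
    (t := {a : V × V | D.Adj a.1 a.2}) ?_ (Set.toFinite _)
  exact ⟨fun a ha => ha.1, fun h => (h (show (u, v) ∈ {a : V × V | D.Adj a.1 a.2} from huv)).2
    ⟨rfl, rfl⟩⟩

theorem IsCompleteColoring.diachromaticNumber_eq {c : V → Fin k} (hk : 2 ≤ k)
    (hc : D.IsCompleteColoring c) (hD : D.arcCount = k * (k - 1)) : D.diachromaticNumber = k := by
  refine IsGreatest.csSup_eq ⟨⟨c, (hc.isHarmoniousColoring hD).1.isAcyclicColoring, hc⟩, ?_⟩
  rintro l ⟨d, -, hd⟩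
  by_contra! hkl
  exact (mul_sub_one_lt_mul_sub_one (by omega) hkl).not_ge (hD ▸ hd.le_arcCount)

theorem IsCompleteColoring.harmoniousNumber_eq {c : V → Fin k} (hk : 2 ≤ k)
    (hc : D.IsCompleteColoring c) (hD : D.arcCount = k * (k - 1)) : D.harmoniousNumber = k := by
  refine IsLeast.csInf_eq ⟨⟨c, hc.isHarmoniousColoring hD⟩, ?_⟩
  rintro l ⟨d, hd⟩
  by_contra! hlk
  exact (mul_sub_one_lt_mul_sub_one hk hlk).not_ge (hD ▸ hd.arcCount_le)

theorem IsCompleteColoring.isKMinimal {c : V → Fin k} (hk : 2 ≤ k)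
    (hc : D.IsCompleteColoring c) (hD : D.arcCount = k * (k - 1)) : D.IsKMinimal k := by
  refine ⟨hc.diachromaticNumber_eq hk hD, fun u v huv => ?_⟩
  have hlt : ∀ l ∈ {l | ∃ d : V → Fin l, (D.deleteArc u v).IsAcyclicColoring d ∧
      (D.deleteArc u v).IsCompleteColoring d}, l ≤ k - 1 := by
    rintro l ⟨d, -, hd⟩
    by_contra! hl
    have h1 := hd.le_arcCount.trans_lt (hD ▸ arcCount_deleteArc_lt huv)
    have h2 := Nat.mul_le_mul (show k ≤ l by omega) (show k - 1 ≤ l - 1 by omega)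
    omega
  exact (csSup_le' hlt).trans_lt (by omega)

end Digraph

theorem arcCount_lexProd_dirCycle {m n : ℕ} (hm : 2 ≤ m) (hn : n ≠ 0) :
    (lexProd (dirCycle m) (dirCycle n)).arcCount = m * n * (n + 1) := by
  have : NeZero n := ⟨hn⟩
  have : NeZero m := ⟨by omega⟩
  have : Fact (1 < m) := ⟨hm⟩
  let f : (ZMod m × ZMod n) × (ZMod n ⊕ Unit) →
      {p : (ZMod m × ZMod n) × (ZMod m × ZMod n) //
        (lexProd (dirCycle m) (dirCycle n)).Adj p.1 p.2} :=
    fun x => match x.2 with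
      | .inl s => ⟨(x.1, (x.1.1 + 1, s)), .inl rfl⟩
      | .inr _ => ⟨(x.1, (x.1.1, x.1.2 + 1)), .inr ⟨rfl, rfl⟩⟩
  have hf : f.Bijective := by
    constructor
    · rintro ⟨⟨i, s⟩, a | a⟩ ⟨⟨j, t⟩, b | b⟩ h <;> have h' := congrArg Subtype.val h <;>
        simp only [f, Prod.mk.injEq] at h' <;> obtain ⟨⟨rfl, rfl⟩, h1, h2⟩ := h'
      · rw [h2]
      · simp at h1
      · simp at h1
      · rfl
    · rintro ⟨⟨⟨i, s⟩, ⟨j, t⟩⟩, h | ⟨h1, h2⟩⟩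
      · obtain rfl : j = i + 1 := h
        exact ⟨((i, s), .inl t), rfl⟩
      · obtain rfl : i = j := h1
        obtain rfl : t = s + 1 := h2
        exact ⟨((i, s), .inr ()), rfl⟩
  rw [Digraph.arcCount, ← Nat.card_congr (Equiv.ofBijective f hf)]
  simp

namespace IsHamFactorization

variable {n : ℕ} {σ : ℕ → ℕ → ℕ}

theorem iterate_val_add_one (h : IsHamFactorization n σ) [NeZero n] {q : ℕ} (hq : q < n - 1)
    (s : ZMod n) : (σ q)^[(s + 1).val] 0 = σ q ((σ q)^[s.val] 0) := by
  rw [← h.iterate_succ_mod hq, ← ZMod.val_natCast, Nat.cast_add, ZMod.natCast_zmod_val,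
    Nat.cast_one]

theorem exists_iterate_val_eq (h : IsHamFactorization n σ) {q a : ℕ} (hq : q < n - 1)
    (ha : a < n) : ∃ s : ZMod n, (σ q)^[s.val] 0 = a := by
  obtain ⟨t, ht, rfl⟩ := h.exists_lt_iterate_eq hq ha
  exact ⟨t, by rw [ZMod.val_natCast_of_lt ht]⟩

/-- The closed walk traversing the cycles `σ 0, …, σ (n - 2)` one after the other, each from `0`
to `0`. -/
def walk (n : ℕ) (σ : ℕ → ℕ → ℕ) (j : ℕ) : ℕ := (σ (j / n))^[j % n] 0

theorem div_lt {j : ℕ} (hj : j < n ^ 2 - n) : j / n < n - 1 := by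
  rcases Nat.eq_zero_or_pos n with rfl | hn
  · simp at hj
  · rw [Nat.div_lt_iff_lt_mul hn, Nat.sub_mul, one_mul, ← sq]
    exact hj

theorem exists_walk_eq (h : IsHamFactorization n σ) {q a : ℕ} (hq : q < n - 1) (ha : a < n) :
    ∃ i : ZMod (n ^ 2 - n), i.val / n = q ∧ walk n σ i.val = a ∧
      walk n σ (i + 1).val = σ q a := by
  obtain ⟨t, ht, rfl⟩ := h.exists_lt_iterate_eq hq ha
  have hqn : q * n + n ≤ n ^ 2 - n := by
    have := Nat.mul_le_mul_right n (show q + 1 ≤ n - 1 from hq)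
    rwa [Nat.sub_mul, one_mul, ← sq, add_mul, one_mul] at this
  have hdiv : ∀ p r, r < n → (p * n + r) / n = p := fun p r hr => by
    rw [mul_comm, Nat.mul_add_div (by omega), Nat.div_eq_of_lt hr, add_zero]
  have hmod : ∀ p r, r < n → (p * n + r) % n = r := fun p r hr => by
    rw [Nat.mul_add_mod', Nat.mod_eq_of_lt hr]
  have hval : ((q * n + t : ℕ) : ZMod (n ^ 2 - n)).val = q * n + t :=
    ZMod.val_natCast_of_lt (by omega)
  refine ⟨(q * n + t : ℕ), by rw [hval, hdiv q t ht], ?_, ?_⟩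
  · rw [hval, walk, hdiv q t ht, hmod q t ht]
  · rw [← Function.iterate_succ_apply' (σ q), ← Nat.cast_add_one, ZMod.val_natCast]
    rcases (show t + 1 ≤ n from ht).lt_or_eq with htn | htn
    · rw [Nat.mod_eq_of_lt (by omega), add_assoc, walk, hdiv q _ htn, hmod q _ htn]
    · rw [Nat.succ_eq_add_one, htn, h.iterate_self hq, add_assoc, htn, walk]
      suffices (q * n + n) % (n ^ 2 - n) % n = 0 by rw [this, Function.iterate_zero_apply]
      rw [Nat.mod_mod_of_dvd _ (by rw [sq]; exact Nat.dvd_sub (dvd_mul_left n n) dvd_rfl)]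
      simp

theorem exists_isCompleteColoring (h : IsHamFactorization n σ) (hn : 2 ≤ n) :
    ∃ c : ZMod (n ^ 2 - n) × ZMod n → Fin (n ^ 2),
      (lexProd (dirCycle (n ^ 2 - n)) (dirCycle n)).IsCompleteColoring c := by
  have : NeZero n := ⟨by omega⟩
  have hm : n < n ^ 2 := by nlinarith
  have : NeZero (n ^ 2 - n) := ⟨by omega⟩
  have hq : ∀ i : ZMod (n ^ 2 - n), i.val / n < n - 1 := fun i => div_lt i.val_lt
  let col : ZMod (n ^ 2 - n) × ZMod n → ℕ := fun x =>
    walk n σ x.1.val * n + (σ (x.1.val / n))^[x.2.val] 0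
  have hcol : ∀ x, col x < n ^ 2 := fun x => by
    have h1 := Nat.mul_le_mul_right n
      (show walk n σ x.1.val + 1 ≤ n from h.iterate_lt (hq x.1) _)
    have h2 := h.iterate_lt (hq x.1) x.2.val
    rw [add_mul, one_mul, ← sq] at h1
    simp only [col]
    omega
  refine ⟨fun x => ⟨col x, hcol x⟩, fun p p' hpp' => ?_⟩
  simp only [Fin.ext_iff]
  have hA : ∀ p : Fin (n ^ 2), p / n < n := fun p =>
    Nat.div_lt_of_lt_mul (sq n ▸ p.2)
  have ha : ∀ p : Fin (n ^ 2), p % n < n := fun p => Nat.mod_lt _ (by omega)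
  have heq : ∀ (x) (p : Fin (n ^ 2)), walk n σ x.1.val = p / n →
      (σ (x.1.val / n))^[x.2.val] 0 = p % n → col x = p := fun x p h1 h2 => by
    simp only [col, h1, h2]
    exact Nat.div_add_mod' _ _
  by_cases hAA : (p / n : ℕ) = p' / n
  · have haa : (p % n : ℕ) ≠ p' % n := fun haa => hpp' <| Fin.ext <| by
      rw [← Nat.div_add_mod' p n, hAA, haa, Nat.div_add_mod']
    obtain ⟨q, hqn, hqa⟩ := h.cover _ (ha p) _ (ha p') haa
    obtain ⟨i, rfl, hi, -⟩ := h.exists_walk_eq hqn (hA p)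
    obtain ⟨s, hs⟩ := h.exists_iterate_val_eq (hq i) (ha p)
    exact ⟨(i, s), (i, s + 1), .inr ⟨rfl, rfl⟩, heq _ _ hi hs, heq _ _ (hi.trans hAA)
      (by rw [h.iterate_val_add_one (hq i), hs, hqa])⟩
  · obtain ⟨q, hqn, hqA⟩ := h.cover _ (hA p) _ (hA p') hAA
    obtain ⟨i, rfl, hi, hi'⟩ := h.exists_walk_eq hqn (hA p)
    obtain ⟨s, hs⟩ := h.exists_iterate_val_eq (hq i) (ha p)
    obtain ⟨s', hs'⟩ := h.exists_iterate_val_eq (hq (i + 1)) (ha p')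
    exact ⟨(i, s), (i + 1, s'), .inl rfl, heq _ _ hi hs, heq _ _ (hi'.trans hqA) hs'⟩

end IsHamFactorization

/-- for `n ≥ 2`, `n ≠ 4, 6`, the digraph `C⃗_{n²−n}[C⃗_n]` is
`n²`-minimal, and its diachromatic and harmonious chromatic numbers equal `n²`. -/
theorem stmt6 (n : ℕ) (hn : 2 ≤ n) (h4 : n ≠ 4) (h6 : n ≠ 6) :
    (lexProd (dirCycle (n ^ 2 - n)) (dirCycle n)).IsKMinimal (n ^ 2) ∧
    (lexProd (dirCycle (n ^ 2 - n)) (dirCycle n)).diachromaticNumber = n ^ 2 ∧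
    (lexProd (dirCycle (n ^ 2 - n)) (dirCycle n)).harmoniousNumber = n ^ 2 := by
  obtain ⟨σ, hσ⟩ := exists_isHamFactorization hn h4 h6
  obtain ⟨c, hc⟩ := hσ.exists_isCompleteColoring hn
  have : NeZero n := ⟨by omega⟩
  have hm : 2 ≤ n ^ 2 - n := by
    have : n + 2 ≤ n ^ 2 := by nlinarith
    omega
  have : NeZero (n ^ 2 - n) := ⟨by omega⟩
  have hk : 2 ≤ n ^ 2 := by omega
  have hD : (lexProd (dirCycle (n ^ 2 - n)) (dirCycle n)).arcCount = n ^ 2 * (n ^ 2 - 1) := by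
    rw [arcCount_lexProd_dirCycle hm (by omega)]
    obtain ⟨l, rfl⟩ : ∃ l, n = l + 1 := ⟨n - 1, by omega⟩
    rw [show (l + 1) ^ 2 - (l + 1) = (l + 1) * l by rw [sq, ← Nat.mul_sub_one]; rfl,
      show (l + 1) ^ 2 - 1 = l * (l + 2) by rw [show (l + 1) ^ 2 = l * (l + 2) + 1 by ring]; rfl]
    ring
  exact ⟨hc.isKMinimal hk hD, hc.diachromaticNumber_eq hk hD, hc.harmoniousNumber_eq hk hD⟩
end

section
/- For every natural number n ≥ 3 with n ≠ 4 and n ≠ 6, and every t with 1 ≤ t ≤ n, the diachromatic number of the lexicographic product C⃗_{n²−n+t}[C⃗_n] equals n². -/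
/-- Successors on the five strip cycles, for even `M`; the point `∞` is written `M + 1`. -/
def evenStripNext (M x : ℤ) : Fin 5 → ℤ :=
  if x = M + 1 then ![1, 0, -1, M, -M]
  else if x = 0 then ![-2, 1, 2, M + 1, -1]
  else if x = 1 then ![0, -1, M + 1, -2, -3]
  else if x = -1 then ![2, 3, 0, 1, M + 1]
  else if x = M then ![M + 1, -M + 2, -M, -M + 1, M - 1]
  else if x = -M then ![-M + 1, M + 1, M - 1, M - 2, M]
  else if x = M - 1 then ![-M + 3, M, -M + 1, -M, -M + 2]
  else if x = -M + 1 then ![M, -M, M - 3, M - 1, M - 2]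
  else if 0 < x then
    if x % 2 = 0 then ![-x - 2, -x - 1, -x, -x + 1, -x + 2]
    else ![-x + 2, -x + 1, -x, -x - 1, -x - 2]
  else if x % 2 = 0 then ![-x + 1, -x, -x + 2, -x - 2, -x - 1]
    else ![-x + 1, -x + 2, -x - 2, -x, -x - 1]

/-- Positions on the five strip cycles, for even `M`. -/
def evenStripRank (M x : ℤ) : Fin 5 → ℤ := ![
  if x = M + 1 then 0 else if x = 0 then 2 else if x = 1 then 1 else if x = -M + 1 then 2 * M
    else if x = M then 2 * M + 1
    else if 0 < x then if x % 2 = 0 then 2 * x + 2 else 2 * x - 2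
    else if x % 2 = 0 then -2 * x - 1 else -2 * x + 3,
  if x = M + 1 then 0 else if x = 1 then 2 else if x = -M + 2 then 2 * M - 2 else if x = -M + 1
    then 2 * M else if x = M then 2 * M - 3 else if x = M - 2 then 2 * M - 1
    else if 0 < x then if x % 2 = 0 then 2 * x + 2 else 2 * x - 2
    else -2 * x + 1,
  if x = M + 1 then 0 else if x = -1 then 1
    else if 0 < x then if x % 2 = 0 then x + 1 else -x + 2 * M + 2
    else if x % 2 = 0 then -x + 2 else x + 2 * M + 3,
  if x = M + 1 then 0 else if x = 0 then 2 * M + 1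
    else if 0 < x then -2 * x + 2 * M + 1
    else if x % 2 = 0 then 2 * x + 2 * M + 4 else 2 * x + 2 * M,
  if x = M + 1 then 0 else if x = -1 then 2 * M + 1 else if x = -M then 1 else if x = M then 2
    else if x = M - 1 then 3
    else if 0 < x then if x % 2 = 0 then -2 * x + 2 * M + 3 else -2 * x + 2 * M - 1
    else if x % 2 = 0 then 2 * x + 2 * M else 2 * x + 2 * M + 4]

/-- Successors on the five strip cycles, for odd `M`; the point `∞` is written `M + 1`. -/
def oddStripNext (M x : ℤ) : Fin 5 → ℤ :=
  if x = M + 1 then ![-M, M, 1, 0, -1]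
  else if x = 0 then ![-2, -1, M + 1, 2, 1]
  else if x = 1 then ![M + 1, 0, -1, -2, -3]
  else if x = -1 then ![0, M + 1, 3, 1, 2]
  else if x = M then ![M - 1, -M + 1, -M, -M + 2, M + 1]
  else if x = -M then ![M, M - 2, M - 1, M + 1, -M + 1]
  else if x = M - 1 then ![-M + 2, -M, -M + 1, M, -M + 3]
  else if x = -M + 1 then ![M - 2, M - 1, M - 3, -M, M]
  else if 0 < x then
    if x % 2 = 0 then ![-x - 2, -x - 1, -x, -x + 1, -x + 2]
    else ![-x + 2, -x + 1, -x, -x - 1, -x - 2]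
  else if x % 2 = 0 then ![-x - 1, -x, -x - 2, -x + 2, -x + 1]
    else ![-x - 1, -x - 2, -x + 2, -x, -x + 1]

/-- Positions on the five strip cycles, for odd `M`. -/
def oddStripRank (M x : ℤ) : Fin 5 → ℤ := ![
  if x = M + 1 then 0 else if x = 0 then 2 * M - 1 else if x = -M then 1 else if x = M then 2
    else if x = M - 1 then 3
    else if 0 < x then if x % 2 = 0 then -2 * x + 2 * M - 1 else -2 * x + 2 * M + 3
    else if x % 2 = 0 then 2 * x + 2 * M + 4 else 2 * x + 2 * M,
  if x = M + 1 then 0 else if x = -1 then 2 * M + 1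
    else if 0 < x then -2 * x + 2 * M + 1
    else if x % 2 = 0 then 2 * x + 2 * M else 2 * x + 2 * M + 4,
  if x = M + 1 then 0 else if x = 0 then 2 * M + 1
    else if 0 < x then if x % 2 = 0 then -x + 2 * M + 1 else x
    else if x % 2 = 0 then x + 2 * M + 2 else -x + 1,
  if x = M + 1 then 0 else if x = -M + 2 then 2 * M - 2 else if x = -M + 1 then 2 * M
    else if x = M then 2 * M - 3 else if x = M - 2 then 2 * M - 1
    else if 0 < x then if x % 2 = 0 then 2 * x - 2 else 2 * x + 2
    else -2 * x + 1,
  if x = M + 1 then 0 else if x = -M + 1 then 2 * M else if x = M then 2 * M + 1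
    else if 0 < x then if x % 2 = 0 then 2 * x - 2 else 2 * x + 2
    else if x % 2 = 0 then -2 * x + 3 else -2 * x - 1]

set_option maxHeartbeats 10000000 in
theorem evenStrip_succ {M x y : ℤ} (hM : 4 ≤ M) (hpar : M % 2 = 0) (h1 : -M ≤ x) (h2 : x ≤ M + 1)
    (j : Fin 5) (hy : y = evenStripNext M x j) :
    (-M ≤ y ∧ y ≤ M + 1) ∧
    (evenStripRank M y j = evenStripRank M x j + 1 ∨
      evenStripRank M x j = 2 * M + 1 ∧ evenStripRank M y j = 0) := by
  obtain ⟨v, hv⟩ : ∃ v, v = evenStripNext M x := ⟨_, rfl⟩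
  rw [← hv] at hy
  unfold evenStripNext at hv
  split_ifs at hv <;> subst hv <;> fin_cases j <;>
    simp only [evenStripRank, Fin.zero_eta, Fin.mk_one, Fin.reduceFinMk, Matrix.cons_val] at hy ⊢ <;>
    omega

set_option maxHeartbeats 10000000 in
theorem oddStrip_succ {M x y : ℤ} (hM : 3 ≤ M) (hpar : M % 2 = 1) (h1 : -M ≤ x) (h2 : x ≤ M + 1)
    (j : Fin 5) (hy : y = oddStripNext M x j) :
    (-M ≤ y ∧ y ≤ M + 1) ∧
    (oddStripRank M y j = oddStripRank M x j + 1 ∨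
      oddStripRank M x j = 2 * M + 1 ∧ oddStripRank M y j = 0) := by
  obtain ⟨v, hv⟩ : ∃ v, v = oddStripNext M x := ⟨_, rfl⟩
  rw [← hv] at hy
  unfold oddStripNext at hv
  split_ifs at hv <;> subst hv <;> fin_cases j <;>
    simp only [oddStripRank, Fin.zero_eta, Fin.mk_one, Fin.reduceFinMk, Matrix.cons_val] at hy ⊢ <;>
    omega

set_option maxHeartbeats 10000000 in
theorem evenStrip_covers {M x y : ℤ} (hM : 4 ≤ M) (hpar : M % 2 = 0) (h1 : -M ≤ x) (h2 : x ≤ M + 1)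
    (h3 : -M ≤ y) (h4 : y ≤ M + 1) (hne : x ≠ y)
    (h : (x ≤ M ∧ y ≤ M ∧ ((-2 ≤ x + y ∧ x + y ≤ 2) ∨ 2 * M - 1 ≤ x + y ∨ x + y ≤ 1 - 2 * M)) ∨
      (x = M + 1 ∧ ((-1 ≤ y ∧ y ≤ 1) ∨ y = M ∨ y = -M)) ∨
      (y = M + 1 ∧ ((-1 ≤ x ∧ x ≤ 1) ∨ x = M ∨ x = -M))) :
    ∃ j, evenStripNext M x j = y := by
  obtain ⟨v, hv⟩ : ∃ v, v = evenStripNext M x := ⟨_, rfl⟩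
  rw [← hv]
  suffices v 0 = y ∨ v 1 = y ∨ v 2 = y ∨ v 3 = y ∨ v 4 = y by
    rcases this with h | h | h | h | h <;> exact ⟨_, h⟩
  unfold evenStripNext at hv
  split_ifs at hv <;> subst hv <;> simp only [Matrix.cons_val] <;> omega

set_option maxHeartbeats 10000000 in
theorem oddStrip_covers {M x y : ℤ} (hM : 3 ≤ M) (hpar : M % 2 = 1) (h1 : -M ≤ x) (h2 : x ≤ M + 1)
    (h3 : -M ≤ y) (h4 : y ≤ M + 1) (hne : x ≠ y)
    (h : (x ≤ M ∧ y ≤ M ∧ ((-2 ≤ x + y ∧ x + y ≤ 2) ∨ 2 * M - 1 ≤ x + y ∨ x + y ≤ 1 - 2 * M)) ∨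
      (x = M + 1 ∧ ((-1 ≤ y ∧ y ≤ 1) ∨ y = M ∨ y = -M)) ∨
      (y = M + 1 ∧ ((-1 ≤ x ∧ x ≤ 1) ∨ x = M ∨ x = -M))) :
    ∃ j, oddStripNext M x j = y := by
  obtain ⟨v, hv⟩ : ∃ v, v = oddStripNext M x := ⟨_, rfl⟩
  rw [← hv]
  suffices v 0 = y ∨ v 1 = y ∨ v 2 = y ∨ v 3 = y ∨ v 4 = y by
    rcases this with h | h | h | h | h <;> exact ⟨_, h⟩
  unfold oddStripNext at hv
  split_ifs at hv <;> subst hv <;> simp only [Matrix.cons_val] <;> omega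

theorem bijective_of_forall_exists_add_one {V : Type*} [Fintype V] [Nonempty V] {n : ℕ} [NeZero n]
    (hV : Fintype.card V = n) {r : V → ZMod n} (hr : ∀ u, ∃ v, r v = r u + 1) :
    Function.Bijective r := by
  rw [Fintype.bijective_iff_surjective_and_card, hV, ZMod.card]
  refine ⟨fun i => ?_, rfl⟩
  obtain ⟨u⟩ := ‹Nonempty V›
  have key : ∀ k : ℕ, ∃ v, r v = r u + k := by
    intro k
    induction k with
    | zero => exact ⟨u, by simp⟩
    | succ k ih =>
      obtain ⟨v, hv⟩ := ih
      obtain ⟨w, hw⟩ := hr v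
      exact ⟨w, by rw [hw, hv]; push_cast; ring⟩
  obtain ⟨v, hv⟩ := key (i - r u).val
  exact ⟨v, by simp [hv]⟩

/-- The position of `v` on the zigzag Hamiltonian cycle `0, 1, -1, 2, -2, …, ∞` of
`Option (ZMod N)`, where `none` is the point `∞`. -/
def zigzagRank (N : ℕ) : Option (ZMod N) → ZMod (N + 1)
  | none => N
  | some x => ((if 0 < x.valMinAbs then 2 * x.valMinAbs - 1 else -2 * x.valMinAbs : ℤ) : ZMod (N + 1))

theorem valMinAbs_intCast {N : ℕ} [NeZero N] {k : ℤ} (h1 : -N < 2 * k) (h2 : 2 * k ≤ N) :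
    (k : ZMod N).valMinAbs = k :=
  (ZMod.valMinAbs_spec _ _).2 ⟨rfl, by constructor <;> linarith⟩

theorem exists_intCast_eq {N : ℕ} [NeZero N] (x : ZMod N) :
    ∃ k : ℤ, -N < 2 * k ∧ 2 * k ≤ N ∧ x = k := by
  have h := x.valMinAbs_mem_Ioc
  exact ⟨x.valMinAbs, by linarith [h.1], by linarith [h.2], by simp⟩

theorem zigzagRank_zero {N : ℕ} : zigzagRank N (some 0) = zigzagRank N none + 1 := by
  have h : ((N : ZMod (N + 1)) + 1) = 0 := by
    exact_mod_cast ZMod.natCast_self (N + 1)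
  simp [zigzagRank, h]

section zigzag

variable {N : ℕ} [NeZero N] {k : ℤ}

theorem zigzagRank_pos (h1 : 0 < k) (h2 : 2 * k ≤ N) :
    zigzagRank N (some k) = ((2 * k - 1 : ℤ) : ZMod (N + 1)) := by
  rw [zigzagRank, valMinAbs_intCast (by omega) h2, if_pos h1]

theorem zigzagRank_nonpos (h1 : k ≤ 0) (h2 : -N < 2 * k) :
    zigzagRank N (some k) = ((-2 * k : ℤ) : ZMod (N + 1)) := by
  rw [zigzagRank, valMinAbs_intCast h2 (by omega), if_neg (by omega)]

theorem zigzagRank_neg (h1 : 0 < k) (h2 : 2 * k < N) :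
    zigzagRank N (some ((-k : ℤ) : ZMod N)) = zigzagRank N (some (k : ZMod N)) + 1 := by
  rw [zigzagRank_pos h1 (by omega), zigzagRank_nonpos (by omega) (by omega)]
  push_cast
  ring

theorem zigzagRank_one_sub (h1 : k ≤ 0) (h2 : 2 * (1 - k) ≤ N) :
    zigzagRank N (some ((1 - k : ℤ) : ZMod N)) = zigzagRank N (some (k : ZMod N)) + 1 := by
  rw [zigzagRank_nonpos h1 (by omega), zigzagRank_pos (by omega) (by omega)]
  push_cast
  ring

theorem zigzagRank_none_of_pos (h1 : 0 < k) (h2 : 2 * k = N) :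
    zigzagRank N none = zigzagRank N (some (k : ZMod N)) + 1 := by
  rw [zigzagRank_pos h1 h2.le, zigzagRank, h2]
  push_cast
  ring

theorem zigzagRank_none_of_nonpos (h1 : k ≤ 0) (h2 : 1 - 2 * k = N) :
    zigzagRank N none = zigzagRank N (some (k : ZMod N)) + 1 := by
  rw [zigzagRank_nonpos h1 (by omega), zigzagRank, ← Int.cast_natCast N, ← h2]
  push_cast
  ring

theorem zigzagRank_bijective : Function.Bijective (zigzagRank N) := by
  refine bijective_of_forall_exists_add_one (by simp [ZMod.card]) fun u => ?_
  rcases u with _ | x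
  · exact ⟨_, zigzagRank_zero⟩
  obtain ⟨k, h1, h2, rfl⟩ := exists_intCast_eq x
  rcases lt_or_ge 0 k with hk | hk
  · rcases h2.lt_or_eq with h | h
    · exact ⟨_, zigzagRank_neg hk h⟩
    · exact ⟨_, zigzagRank_none_of_pos hk h⟩
  · rcases le_or_gt (2 * (1 - k)) N with h | h
    · exact ⟨_, zigzagRank_one_sub hk h⟩
    · exact ⟨_, zigzagRank_none_of_nonpos hk (by omega)⟩

end zigzag

/-- Hamiltonian cycles decomposing the complete symmetric digraph on `ZMod n`, all listed from `0`. -/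
def HasHamiltonianDecomposition (n : ℕ) : Prop :=
  ∃ R : ℕ → ZMod n → ZMod n, (∀ q, Function.Bijective (R q)) ∧ (∀ q, R q 0 = 0) ∧
    ∀ u v, u ≠ v → ∃ q < n - 1, ∃ i, R q i = u ∧ R q (i + 1) = v

theorem HasHamiltonianDecomposition.of_rank {n : ℕ} [NeZero n] {V ι : Type*} [Fintype V] [Fintype ι]
    (hV : Fintype.card V = n) (hι : Fintype.card ι = n - 1) (r : ι → V → ZMod n)
    (hr : ∀ j, Function.Bijective (r j)) (hcov : ∀ u v, u ≠ v → ∃ j, r j v = r j u + 1) :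
    HasHamiltonianDecomposition n := by
  classical
  let e : V ≃ ZMod n := Fintype.equivOfCardEq (by rw [hV, ZMod.card])
  let f : ι ≃ Fin (n - 1) := Fintype.equivFinOfCardEq hι
  let E : ι → V ≃ ZMod n := fun j => Equiv.ofBijective (r j) (hr j)
  let T : ι → ZMod n ≃ ZMod n := fun j =>
    (Equiv.addRight (E j (e.symm 0))).trans ((E j).symm.trans e)
  refine ⟨fun q => if h : q < n - 1 then T (f.symm ⟨q, h⟩) else id, fun q => ?_, fun q => ?_,
    fun u v huv => ?_⟩
  · dsimp only
    split_ifs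
    · exact (T _).bijective
    · exact Function.bijective_id
  · dsimp only
    split_ifs <;> simp [T]
  · obtain ⟨j, hj⟩ := hcov (e.symm u) (e.symm v) (by simpa using huv)
    refine ⟨f j, (f j).2, r j (e.symm u) - r j (e.symm 0), ?_⟩
    have hE : ∀ x, E j x = r j x := fun _ => rfl
    have h2 : r j (e.symm u) - r j (e.symm 0) + 1 + r j (e.symm 0) = r j (e.symm v) := by
      rw [hj]; ring
    simp only [(f j).2, dif_pos, Fin.eta, Equiv.symm_apply_apply, T, Equiv.trans_apply,
      Equiv.coe_addRight, hE, sub_add_cancel, h2]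
    simp only [← hE, Equiv.symm_apply_apply, Equiv.apply_symm_apply, and_self]

/-- Translation of `Option (ZMod N)` fixing `none`. -/
def optionShift {N : ℕ} (a : ZMod N) : Option (ZMod N) ≃ Option (ZMod N) :=
  Equiv.optionCongr (Equiv.subRight a)

theorem hasHamiltonianDecomposition_odd {M : ℕ} (hM : 1 ≤ M) :
    HasHamiltonianDecomposition (2 * M + 1) := by
  have : NeZero (2 * M) := ⟨by omega⟩
  refine .of_rank (V := Option (ZMod (2 * M))) (ι := ZMod (2 * M))
    (by simp [ZMod.card]) (by simp [ZMod.card])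
    (fun a u => zigzagRank (2 * M) (optionShift a u))
    (fun a => zigzagRank_bijective.comp (optionShift a).bijective) fun u v huv => ?_
  rcases u with _ | u <;> rcases v with _ | v
  · exact absurd rfl huv
  · exact ⟨v, by simpa [optionShift] using zigzagRank_zero⟩
  · refine ⟨u - (M : ℤ), ?_⟩
    simpa [optionShift] using
      zigzagRank_none_of_pos (N := 2 * M) (k := M) (by omega) (by push_cast; ring)
  · set e := (v - u).val with he
    have hlt : e < 2 * M := ZMod.val_lt _
    have hv : v = u + (e : ZMod (2 * M)) := by simp [he]
    have hpos : 0 < e := by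
      rw [Nat.pos_iff_ne_zero, he, Ne, ZMod.val_eq_zero, sub_eq_zero]
      exact fun h => huv (by rw [h])
    rcases Nat.even_or_odd' e with ⟨j, hj | hj⟩
    · refine ⟨u - ((M - j : ℤ) : ZMod (2 * M)), ?_⟩
      have h := zigzagRank_neg (N := 2 * M) (k := M - j) (by omega) (by push_cast; omega)
      have h0 : (2 * M : ZMod (2 * M)) = 0 := by exact_mod_cast ZMod.natCast_self (2 * M)
      have h2 : v - (u - ((M - j : ℤ) : ZMod (2 * M))) = ((-(M - j) : ℤ) : ZMod (2 * M)) := by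
        rw [hv, hj]; push_cast; linear_combination h0
      simpa only [optionShift, Equiv.optionCongr_apply, Option.map_some, Equiv.subRight_apply,
        sub_sub_cancel, h2] using h
    · refine ⟨u - ((-j : ℤ) : ZMod (2 * M)), ?_⟩
      have h := zigzagRank_one_sub (N := 2 * M) (k := -j) (by omega) (by push_cast; omega)
      have h2 : v - (u - ((-j : ℤ) : ZMod (2 * M))) = ((1 - -j : ℤ) : ZMod (2 * M)) := by
        rw [hv, hj]; push_cast; ring
      simpa only [optionShift, Equiv.optionCongr_apply, Option.map_some, Equiv.subRight_apply,
        sub_sub_cancel, h2] using h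

/-- Five integer-valued ranks on `[-M, M + 1]` with their successor maps, where `M + 1` stands
for the point `∞`; the arcs cover all ordered pairs with sum in `[-2, 2]` modulo `2 * M + 1`. -/
theorem exists_strip {M : ℤ} (hM : 3 ≤ M) : ∃ next rank : ℤ → Fin 5 → ℤ,
    (∀ x j, -M ≤ x → x ≤ M + 1 → (-M ≤ next x j ∧ next x j ≤ M + 1) ∧
      (rank (next x j) j = rank x j + 1 ∨ rank x j = 2 * M + 1 ∧ rank (next x j) j = 0)) ∧
    ∀ x y, -M ≤ x → x ≤ M + 1 → -M ≤ y → y ≤ M + 1 → x ≠ y →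
      ((x ≤ M ∧ y ≤ M ∧ ((-2 ≤ x + y ∧ x + y ≤ 2) ∨ 2 * M - 1 ≤ x + y ∨ x + y ≤ 1 - 2 * M)) ∨
        (x = M + 1 ∧ ((-1 ≤ y ∧ y ≤ 1) ∨ y = M ∨ y = -M)) ∨
        (y = M + 1 ∧ ((-1 ≤ x ∧ x ≤ 1) ∨ x = M ∨ x = -M))) →
      ∃ j, next x j = y := by
  rcases Int.emod_two_eq_zero_or_one M with h | h
  · exact ⟨evenStripNext M, evenStripRank M,
      fun x j h1 h2 => evenStrip_succ (by omega) h h1 h2 j rfl,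
      fun x y h1 h2 h3 h4 hne hxy => evenStrip_covers (by omega) h h1 h2 h3 h4 hne hxy⟩
  · exact ⟨oddStripNext M, oddStripRank M,
      fun x j h1 h2 => oddStrip_succ hM h h1 h2 j rfl,
      fun x y h1 h2 h3 h4 hne hxy => oddStrip_covers hM h h1 h2 h3 h4 hne hxy⟩

/-- The sum of two points, where `∞` takes the value of the other point. -/
def pairSum {N : ℕ} : Option (ZMod N) → Option (ZMod N) → ZMod N
  | some x, some y => x + y
  | some x, none => 2 * x
  | none, some y => 2 * y
  | none, none => 0

theorem pairSum_optionShift {N : ℕ} {u v : Option (ZMod N)} (huv : u ≠ v) (a : ZMod N) :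
    pairSum (optionShift a u) (optionShift a v) = pairSum u v - 2 * a := by
  rcases u with _ | u <;> rcases v with _ | v
  · exact absurd rfl huv
  all_goals simp [pairSum, optionShift]; ring

section

variable {M : ℕ}

theorem intCast_eq_intCast_of_bounds {a b : ℤ} (h : (a : ZMod (2 * M + 1)) = b)
    (h1 : a - b < 2 * M + 1) (h2 : b - a < 2 * M + 1) : a = b := by
  rw [← sub_eq_zero, ← Int.cast_sub, ZMod.intCast_zmod_eq_zero_iff_dvd] at h
  exact sub_eq_zero.1 (Int.eq_zero_of_abs_lt_dvd h (by rw [abs_lt]; push_cast; constructor <;> omega))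

theorem zigzagRank_adj_none {x : ZMod (2 * M + 1)} (h : 2 * x = 0 ∨ 2 * x = 1) :
    zigzagRank (2 * M + 1) (some x) = zigzagRank (2 * M + 1) none + 1 ∨
      zigzagRank (2 * M + 1) none = zigzagRank (2 * M + 1) (some x) + 1 := by
  obtain ⟨k, h1, h2, rfl⟩ := exists_intCast_eq x
  push_cast at h1 h2
  rcases h with h | h
  · have : 2 * k = 0 :=
      intCast_eq_intCast_of_bounds (M := M) (by push_cast; exact h) (by omega) (by omega)
    obtain rfl : k = 0 := by omega
    left
    simpa using zigzagRank_zero (N := 2 * M + 1)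
  · have : 2 * k + 2 * M = 0 := by
      have h0 : (2 * M + 1 : ZMod (2 * M + 1)) = 0 := by exact_mod_cast ZMod.natCast_self (2 * M + 1)
      rcases le_or_gt k 0 with hk | hk
      · exact intCast_eq_intCast_of_bounds (M := M) (by push_cast; linear_combination h + h0)
          (by omega) (by omega)
      · have : 2 * k = 1 :=
          intCast_eq_intCast_of_bounds (M := M) (by push_cast; exact h) (by omega) (by omega)
        omega
    exact .inr (zigzagRank_none_of_nonpos (by omega) (by push_cast; omega))

theorem zigzagRank_adj {u v : Option (ZMod (2 * M + 1))} (huv : u ≠ v)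
    (h : pairSum u v = 0 ∨ pairSum u v = 1) :
    zigzagRank _ v = zigzagRank _ u + 1 ∨ zigzagRank _ u = zigzagRank _ v + 1 := by
  rcases u with _ | x <;> rcases v with _ | y
  · exact absurd rfl huv
  · exact zigzagRank_adj_none h
  · exact (zigzagRank_adj_none h).symm
  obtain ⟨k, h1, h2, rfl⟩ := exists_intCast_eq x
  push_cast at h1 h2
  rcases h with h | h
  · have hy : y = ((-k : ℤ) : ZMod (2 * M + 1)) := by
      push_cast; exact eq_neg_of_add_eq_zero_right h
    subst hy
    rcases lt_trichotomy k 0 with hk | rfl | hk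
    · right
      have := zigzagRank_neg (N := 2 * M + 1) (k := -k) (by omega) (by push_cast; omega)
      rwa [neg_neg] at this
    · exact absurd (by simp) huv
    · exact .inl (zigzagRank_neg hk (by push_cast; omega))
  · have hy : y = ((1 - k : ℤ) : ZMod (2 * M + 1)) := by
      push_cast; exact eq_sub_of_add_eq' h
    subst hy
    rcases le_or_gt k 0 with hk | hk
    · rcases eq_or_ne (2 * k) (-(2 * M : ℤ)) with hk' | hk'
      · refine absurd ?_ huv
        have h0 : (2 * M + 1 : ZMod (2 * M + 1)) = 0 := by
          exact_mod_cast ZMod.natCast_self (2 * M + 1)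
        obtain rfl : k = -M := by omega
        push_cast
        congr 1
        linear_combination -h0
      · exact .inl (zigzagRank_one_sub hk (by push_cast; omega))
    · right
      have := zigzagRank_one_sub (N := 2 * M + 1) (k := 1 - k) (by omega) (by push_cast; omega)
      rwa [sub_sub_cancel] at this

/-- Integer coordinates on `Option (ZMod (2 * M + 1))`, with values in `[-M, M + 1]`. -/
def coord : Option (ZMod (2 * M + 1)) → ℤ
  | none => M + 1
  | some x => x.valMinAbs

theorem coord_none : coord (none : Option (ZMod (2 * M + 1))) = M + 1 := rfl

theorem coord_some_intCast {k : ℤ} (h1 : -M ≤ k) (h2 : k ≤ M) :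
    coord (some (k : ZMod (2 * M + 1))) = k :=
  valMinAbs_intCast (N := 2 * M + 1) (by push_cast; omega) (by push_cast; omega)

theorem exists_intCast_eq_of_odd (x : ZMod (2 * M + 1)) : ∃ k : ℤ, -M ≤ k ∧ k ≤ M ∧ x = k := by
  obtain ⟨k, h1, h2, rfl⟩ := exists_intCast_eq x
  push_cast at h1 h2
  exact ⟨k, by omega, by omega, rfl⟩

theorem coord_bounds (u : Option (ZMod (2 * M + 1))) : -M ≤ coord u ∧ coord u ≤ M + 1 := by
  rcases u with _ | x
  · simp only [coord]; omega
  · obtain ⟨k, h1, h2, rfl⟩ := exists_intCast_eq_of_odd x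
    rw [coord_some_intCast h1 h2]; omega

theorem exists_coord_eq {y : ℤ} (h1 : -M ≤ y) (h2 : y ≤ M + 1) :
    ∃ v : Option (ZMod (2 * M + 1)), coord v = y := by
  rcases h2.lt_or_eq with h | rfl
  · exact ⟨_, coord_some_intCast h1 (by omega)⟩
  · exact ⟨none, rfl⟩

theorem coord_injective : Function.Injective (coord (M := M)) := by
  intro u v h
  rcases u with _ | x <;> rcases v with _ | y
  · rfl
  · obtain ⟨k, h1, h2, rfl⟩ := exists_intCast_eq_of_odd y
    rw [coord_some_intCast h1 h2, coord] at h; omega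
  · obtain ⟨k, h1, h2, rfl⟩ := exists_intCast_eq_of_odd x
    rw [coord_some_intCast h1 h2, coord] at h; omega
  · exact congrArg some (ZMod.injective_valMinAbs h)

theorem intCast_val_bounds {s : ℤ} (h1 : -(2 * M) ≤ s) (h2 : s ≤ 2 * M) :
    s = (s : ZMod (2 * M + 1)).val ∨
      s < 0 ∧ s + (2 * M + 1) = (s : ZMod (2 * M + 1)).val := by
  rw [ZMod.val_intCast]
  push_cast
  rcases le_or_gt 0 s with h | h
  · rw [Int.emod_eq_of_lt h (by omega)]; exact .inl rfl
  · rw [← Int.add_emod_right, Int.emod_eq_of_lt (by omega) (by omega)]; exact .inr ⟨h, rfl⟩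

theorem coord_of_pairSum {u v : Option (ZMod (2 * M + 1))} (huv : u ≠ v)
    (h : (pairSum u v).val ≤ 2 ∨ 2 * M - 1 ≤ (pairSum u v).val) (hM : 3 ≤ M) :
    (coord u ≤ M ∧ coord v ≤ M ∧ ((-2 ≤ coord u + coord v ∧ coord u + coord v ≤ 2) ∨
        2 * (M : ℤ) - 1 ≤ coord u + coord v ∨ coord u + coord v ≤ 1 - 2 * M)) ∨
      (coord u = M + 1 ∧ ((-1 ≤ coord v ∧ coord v ≤ 1) ∨ coord v = M ∨ coord v = -M)) ∨
      (coord v = M + 1 ∧ ((-1 ≤ coord u ∧ coord u ≤ 1) ∨ coord u = M ∨ coord u = -M)) := by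
  rcases u with _ | x <;> rcases v with _ | y
  · exact absurd rfl huv
  · obtain ⟨l, h3, h4, rfl⟩ := exists_intCast_eq_of_odd y
    have := intCast_val_bounds (M := M) (s := 2 * l) (by omega) (by omega)
    rw [show pairSum none (some (l : ZMod (2 * M + 1))) = ((2 * l : ℤ) : ZMod (2 * M + 1)) by
      simp [pairSum]] at h
    rw [coord_some_intCast h3 h4]
    rw [coord_none]
    omega
  · obtain ⟨k, h1, h2, rfl⟩ := exists_intCast_eq_of_odd x
    have := intCast_val_bounds (M := M) (s := 2 * k) (by omega) (by omega)
    rw [show pairSum (some (k : ZMod (2 * M + 1))) none = ((2 * k : ℤ) : ZMod (2 * M + 1)) by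
      simp [pairSum]] at h
    rw [coord_some_intCast h1 h2]
    rw [coord_none]
    omega
  · obtain ⟨k, h1, h2, rfl⟩ := exists_intCast_eq_of_odd x
    obtain ⟨l, h3, h4, rfl⟩ := exists_intCast_eq_of_odd y
    have := intCast_val_bounds (M := M) (s := k + l) (by omega) (by omega)
    rw [show pairSum (some (k : ZMod (2 * M + 1))) (some (l : ZMod (2 * M + 1))) =
      ((k + l : ℤ) : ZMod (2 * M + 1)) by simp [pairSum]] at h
    rw [coord_some_intCast h1 h2, coord_some_intCast h3 h4]
    omega

end

theorem hasHamiltonianDecomposition_even {M : ℕ} (hM : 3 ≤ M) :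
    HasHamiltonianDecomposition (2 * M + 2) := by
  obtain ⟨next, rank, hsucc, hcov⟩ := exists_strip (M := M) (by omega)
  let shift : Fin (M - 2) → ZMod (2 * M + 1) := fun c => (c : ℕ) + 2 + M
  let z : Fin (M - 2) → Option (ZMod (2 * M + 1)) → ZMod (2 * M + 2) :=
    fun c u => zigzagRank (2 * M + 1) (optionShift (shift c) u)
  have hz : ∀ c, Function.Bijective (z c) :=
    fun c => zigzagRank_bijective.comp (optionShift _).bijective
  refine .of_rank (V := Option (ZMod (2 * M + 1))) (ι := Fin 5 ⊕ Fin (M - 2) ⊕ Fin (M - 2))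
    (by simp [ZMod.card]) (by simp only [Fintype.card_sum, Fintype.card_fin]; omega)
    (Sum.elim (fun j u => (rank (coord u) j : ZMod (2 * M + 2)))
      (Sum.elim (fun c u => z c u) (fun c u => -z c u))) ?_ ?_
  · rintro (j | c | c)
    · refine bijective_of_forall_exists_add_one (by simp [ZMod.card]) fun u => ?_
      obtain ⟨⟨h1, h2⟩, h⟩ := hsucc (coord u) j (coord_bounds u).1 (coord_bounds u).2
      obtain ⟨v, hv⟩ := exists_coord_eq h1 h2
      refine ⟨v, ?_⟩
      simp only [Sum.elim_inl, hv]
      rcases h with h | ⟨h, h'⟩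
      · rw [h]; push_cast; rfl
      · rw [h, h']
        have h0 : (2 * M + 2 : ZMod (2 * M + 2)) = 0 := by
          exact_mod_cast ZMod.natCast_self (2 * M + 2)
        push_cast
        linear_combination -h0
    · exact hz c
    · exact (Equiv.neg _).bijective.comp (hz c)
  · intro u v huv
    by_cases h : (pairSum u v).val ≤ 2 ∨ 2 * M - 1 ≤ (pairSum u v).val
    · obtain ⟨j, hj⟩ := hcov (coord u) (coord v) (coord_bounds u).1 (coord_bounds u).2
        (coord_bounds v).1 (coord_bounds v).2 (coord_injective.ne huv) (coord_of_pairSum huv h hM)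
      obtain ⟨-, h⟩ := hsucc (coord u) j (coord_bounds u).1 (coord_bounds u).2
      refine ⟨.inl j, ?_⟩
      simp only [Sum.elim_inl]
      rw [hj] at h
      rcases h with h | ⟨h, h'⟩
      · rw [h]; push_cast; rfl
      · rw [h, h']
        have h0 : (2 * M + 2 : ZMod (2 * M + 2)) = 0 := by
          exact_mod_cast ZMod.natCast_self (2 * M + 2)
        push_cast
        linear_combination -h0
    · set s := (pairSum u v).val with hs
      let c : Fin (M - 2) := ⟨(s - 3) / 2, by omega⟩
      have hsum : pairSum (optionShift (shift c) u) (optionShift (shift c) v) = 0 ∨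
          pairSum (optionShift (shift c) u) (optionShift (shift c) v) = 1 := by
        rw [pairSum_optionShift huv]
        have h1 : pairSum u v = (s : ZMod (2 * M + 1)) := by simp [hs]
        have h0 : (2 * M + 1 : ZMod (2 * M + 1)) = 0 := by
          exact_mod_cast ZMod.natCast_self (2 * M + 1)
        have h3 : s = 2 * (c : ℕ) + 3 ∨ s = 2 * (c : ℕ) + 4 := by simp only [c]; omega
        rw [h1]
        rcases h3 with h3 | h3
        · left; rw [h3]; simp only [shift]; push_cast; linear_combination -h0
        · right; rw [h3]; simp only [shift]; push_cast; linear_combination -h0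
      rcases zigzagRank_adj ((optionShift (shift c)).injective.ne huv) hsum with h | h
      · exact ⟨.inr (.inl c), h⟩
      · refine ⟨.inr (.inr c), ?_⟩
        change -z c v = -z c u + 1
        have h' : z c u = z c v + 1 := h
        rw [h']; ring

theorem hasHamiltonianDecomposition {n : ℕ} (hn : 3 ≤ n) (h4 : n ≠ 4) (h6 : n ≠ 6) :
    HasHamiltonianDecomposition n := by
  rcases Nat.even_or_odd' n with ⟨k, rfl | rfl⟩
  · obtain ⟨M, rfl⟩ : ∃ M, k = M + 1 := ⟨k - 1, by omega⟩
    exact hasHamiltonianDecomposition_even (by omega)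
  · exact hasHamiltonianDecomposition_odd (by omega)

theorem le_of_isCompleteColoring_lexProd_dirCycle {m n k : ℕ} (hn : 1 ≤ n) (hm : m ≤ n ^ 2)
    (hm0 : m ≠ 0) {c : ZMod m × ZMod n → Fin k}
    (hc : (lexProd (dirCycle m) (dirCycle n)).IsCompleteColoring c) : k ≤ n ^ 2 := by
  have : NeZero m := ⟨hm0⟩
  have : NeZero n := ⟨by omega⟩
  by_contra! hk
  let f : (ZMod m × ZMod n) × Option (ZMod n) → ZMod m × ZMod n :=
    fun p => p.2.elim (p.1.1, p.1.2 + 1) fun w => (p.1.1 + 1, w)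
  have hclass : ∀ i, n ≤ (Finset.univ.filter fun v => c v = i).card := by
    intro i
    have hsub : Finset.univ.erase i ⊆
        ((Finset.univ.filter fun v => c v = i) ×ˢ Finset.univ).image (c ∘ f) := by
      intro j hj
      obtain ⟨u, v, huv, hu, hv⟩ := hc i j (Finset.ne_of_mem_erase hj).symm
      rw [Finset.mem_image]
      rcases huv with huv | ⟨h1, h2⟩
      · refine ⟨(u, some v.2), by simp [hu], ?_⟩
        rw [← hv, Function.comp_apply]
        exact congrArg c (Prod.ext huv.symm rfl)
      · refine ⟨(u, none), by simp [hu], ?_⟩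
        rw [← hv, Function.comp_apply]
        exact congrArg c (Prod.ext h1 h2.symm)
    have h := (Finset.card_le_card hsub).trans Finset.card_image_le
    rw [Finset.card_erase_of_mem (Finset.mem_univ i), Finset.card_product, Finset.card_univ,
      Finset.card_univ, Fintype.card_option, ZMod.card, Fintype.card_fin] at h
    by_contra! hlt
    have h1 := Nat.mul_le_mul_right (n + 1) (Nat.le_sub_one_of_lt hlt)
    obtain ⟨a, rfl⟩ : ∃ a, n = a + 1 := ⟨n - 1, by omega⟩
    rw [Nat.add_sub_cancel] at h1
    have h2 : (a + 1) ^ 2 = a * (a + 1 + 1) + 1 := by ring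
    omega
  have hsum := Finset.card_eq_sum_card_fiberwise (f := c) (s := Finset.univ) (t := Finset.univ)
    (fun _ _ => Finset.mem_coe.2 (Finset.mem_univ _))
  have h := Finset.sum_le_sum fun i (_ : i ∈ Finset.univ) => hclass i
  rw [← hsum, Finset.sum_const, Finset.card_univ, Finset.card_univ, Fintype.card_fin,
    Fintype.card_prod, ZMod.card, ZMod.card, smul_eq_mul] at h
  have := Nat.le_of_mul_le_mul_right h (by omega)
  omega

/-- Arcs of a lexicographic product over a directed cycle that never stay inside a copy go around
the whole cycle. -/
theorem exists_mem_of_transGen_lexProd_dirCycle {m : ℕ} [NeZero m] {W : Type*}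
    {r : ZMod m × W → ZMod m × W → Prop} (hr : ∀ a b, r a b → b.1 = a.1 + 1)
    {v : ZMod m × W} (hv : Relation.TransGen r v v) (x : ZMod m) : ∃ w b, r (x, w) b := by
  have key : ∀ k : ℕ, ∃ w, Relation.TransGen r (v.1 + k, w) (v.1 + k, w) := by
    intro k
    induction k with
    | zero => exact ⟨v.2, by simpa using hv⟩
    | succ k ih =>
      obtain ⟨w, hw⟩ := ih
      obtain ⟨u, hu, hu'⟩ := Relation.TransGen.head'_iff.1 hw
      have h1 : u = (v.1 + (k + 1 : ℕ), u.2) :=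
        Prod.ext (by rw [hr _ _ hu]; push_cast; ring) rfl
      exact ⟨u.2, h1 ▸ Relation.TransGen.tail' hu' hu⟩
  obtain ⟨w, hw⟩ := key (x - v.1).val
  obtain ⟨b, hb, -⟩ := Relation.TransGen.head'_iff.1 hw
  exact ⟨w, b, by simpa using hb⟩

theorem exists_coloring_lexProd_dirCycle {n m : ℕ} (hn : 3 ≤ n) (hm : n * (n - 1) < m)
    (hdec : HasHamiltonianDecomposition n) :
    ∃ c : ZMod m × ZMod n → Fin (n ^ 2),
      (lexProd (dirCycle m) (dirCycle n)).IsAcyclicColoring c ∧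
        (lexProd (dirCycle m) (dirCycle n)).IsCompleteColoring c := by
  obtain ⟨R, hbij, hzero, hcov⟩ := hdec
  have : NeZero n := ⟨by omega⟩
  have : NeZero m := ⟨by omega⟩
  have : Fact (1 < n) := ⟨by omega⟩
  let e : ZMod n × ZMod n ≃ Fin (n ^ 2) :=
    Fintype.equivOfCardEq (by simp [ZMod.card, sq])
  let g : ℕ → ZMod n → ZMod n × ZMod n := fun k w => (R (k / n) k, R (k / n) w)
  have hg : ∀ k w, (g (k + 1) w).1 = R (k / n) (k + 1) := by
    intro k w
    simp only [g, Nat.succ_div]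
    split_ifs with h
    · have h0 : ((k + 1 : ℕ) : ZMod n) = 0 := (ZMod.natCast_eq_zero_iff _ _).2 h
      rw [h0, hzero, ← hzero (k / n), ← h0]
      push_cast
      rfl
    · push_cast
      rfl
  let c₀ : ZMod m × ZMod n → ZMod n × ZMod n := fun v => g v.1.val v.2
  have hbound : ∀ q < n - 1, ∀ i : ZMod n, q * n + i.val + 1 < m := by
    intro q hq i
    have h1 : i.val < n := ZMod.val_lt i
    have h2 : (q + 1) * n ≤ (n - 1) * n := Nat.mul_le_mul_right n hq
    rw [Nat.mul_comm] at hm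
    rw [Nat.succ_mul] at h2
    omega
  have hc₀ : ∀ k < m, ∀ w, c₀ (k, w) = g k w := by
    intro k hk w
    simp only [c₀, ZMod.val_natCast_of_lt hk]
  have hdiv : ∀ q (i : ZMod n), (q * n + i.val) / n = q := by
    intro q i
    rw [Nat.mul_comm, Nat.mul_add_div (by omega), Nat.div_eq_of_lt (ZMod.val_lt i), add_zero]
  have hcast : ∀ q (i : ZMod n), ((q * n + i.val : ℕ) : ZMod n) = i := by
    intro q i
    simp
  refine ⟨e ∘ c₀, fun i => ?_, fun i j hij => ?_⟩
  · rintro ⟨v, hv⟩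
    have hr : ∀ a b, a ∈ {v | (e ∘ c₀) v = i} ∧ b ∈ {v | (e ∘ c₀) v = i} ∧
        (lexProd (dirCycle m) (dirCycle n)).Adj a b → b.1 = a.1 + 1 := by
      rintro ⟨x, w⟩ ⟨y, w'⟩ ⟨ha, hb, h | ⟨h1, h2⟩⟩
      · exact h
      · obtain rfl : x = y := h1
        obtain rfl : w' = w + 1 := h2
        have h := congrArg Prod.snd (e.injective (ha.trans hb.symm))
        have h3 := (hbij _).injective h
        exact absurd h3 (by simp)
    obtain ⟨w, b, h0, -⟩ := exists_mem_of_transGen_lexProd_dirCycle hr hv ((0 : ℕ) : ZMod m)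
    obtain ⟨w', b', h1, -⟩ := exists_mem_of_transGen_lexProd_dirCycle hr hv ((1 : ℕ) : ZMod m)
    have hm1 : 1 < m := by
      have := hbound 0 (by omega) 0
      omega
    have h := congrArg Prod.fst (e.injective (h0.trans h1.symm))
    rw [hc₀ 0 (by omega), hc₀ 1 hm1, hg 0 w'] at h
    have h' := (hbij _).injective h
    simp at h'
  · obtain ⟨⟨a, b⟩, rfl⟩ := e.surjective i
    obtain ⟨⟨a', b'⟩, rfl⟩ := e.surjective j
    simp only [Function.comp_apply, EmbeddingLike.apply_eq_iff_eq]
    by_cases haa : a = a'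
    · subst haa
      obtain ⟨q, hq, i, hi, hi'⟩ := hcov b b' fun h => hij (by rw [h])
      obtain ⟨p, hp⟩ := (hbij q).surjective a
      have hlt := hbound q hq p
      refine ⟨((q * n + p.val : ℕ), i), ((q * n + p.val : ℕ), i + 1), .inr ⟨rfl, rfl⟩, ?_, ?_⟩
      · rw [hc₀ _ (by omega)]
        simp only [g, hdiv, hcast, hp, hi]
      · rw [hc₀ _ (by omega)]
        simp only [g, hdiv, hcast, hp, hi']
    · obtain ⟨q, hq, i, hi, hi'⟩ := hcov a a' haa
      have hlt := hbound q hq i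
      obtain ⟨w, hw⟩ := (hbij q).surjective b
      obtain ⟨w', hw'⟩ := (hbij ((q * n + i.val + 1) / n)).surjective b'
      refine ⟨((q * n + i.val : ℕ), w), ((q * n + i.val + 1 : ℕ), w'), .inl ?_, ?_, ?_⟩
      · simp [dirCycle]
      · rw [hc₀ _ (by omega)]
        simp only [g, hdiv, hcast, hw, hi]
      · rw [hc₀ _ hlt]
        refine Prod.ext ?_ hw'
        rw [hg, hdiv, hcast, hi']

/-- for `n ≥ 3`, `n ≠ 4, 6`, and `1 ≤ t ≤ n`,
`dac(C⃗_{n²−n+t}[C⃗_n]) = n²`. -/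
theorem stmt9 (n t : ℕ) (hn : 3 ≤ n) (h4 : n ≠ 4) (h6 : n ≠ 6)
    (ht1 : 1 ≤ t) (ht2 : t ≤ n) :
    (lexProd (dirCycle (n ^ 2 - n + t)) (dirCycle n)).diachromaticNumber = n ^ 2 := by
  have hsq : n * (n - 1) = n ^ 2 - n := by rw [Nat.mul_sub_one, sq]
  have hle : n ≤ n ^ 2 := Nat.le_self_pow two_ne_zero n
  refine IsGreatest.csSup_eq ⟨exists_coloring_lexProd_dirCycle hn (by omega)
    (hasHamiltonianDecomposition hn h4 h6), ?_⟩
  rintro k ⟨c, -, hc⟩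
  exact le_of_isCompleteColoring_lexProd_dirCycle (by omega) (by omega) (by omega) hc
end
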